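/- arXiv:2012.13069 — 2 statements merged into one kernel-verified Lean document; each statement's English description precedes it below -/
import Mathlib

section
/- Let n ≥ 3, T > 0, and let R₀ : ℝ^n → ℝ be continuous, nonnegative, and bounded. Let v : ℝ^n → ℝ be a bounded C² function satisfying −c_n Δv + R₀ v = R₀ on ℝ^n, and let C ≥ 1. Let u : [0,T] × ℝ^n → ℝ be smooth with 0 < c₁ ≤ u(t,x) ≤ c₂ for some constants c₁, c₂ and all (t,x), satisfying the Yamabe flow equation ((n+2)/(n−2)) u^{4/(n−2)} ∂_t u = c_n Δ_x u − R₀ u on [0,T] × ℝ^n. Then: (i) if u(0,x) ≥ 1 − C v(x) for all x, then u(t,x) ≥ 1 − C v(x) for all (t,x) ∈ [0,T] × ℝ^n; (ii) if u(0,x) ≤ 1 + C v(x) for all x, then u(t,x) ≤ 1 + C v(x) for all (t,x) ∈ [0,T] × ℝ^n. -/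
open Filter

/-- The Euclidean Laplacian on `ℝ^n`: the sum of the second partial derivatives. -/
noncomputable def lap {n : ℕ} (f : EuclideanSpace ℝ (Fin n) → ℝ)
    (x : EuclideanSpace ℝ (Fin n)) : ℝ :=
  ∑ i, fderiv ℝ (fun y => fderiv ℝ f y (EuclideanSpace.single i 1)) x (EuclideanSpace.single i 1)

section Laplacian

variable {n : ℕ} {f g : EuclideanSpace ℝ (Fin n) → ℝ}

lemma ContDiff.differentiable_fderiv_apply (hf : ContDiff ℝ 2 f) (e : EuclideanSpace ℝ (Fin n)) :
    Differentiable ℝ (fun y => fderiv ℝ f y e) :=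
  ((hf.fderiv_right (m := 1) (by norm_num)).clm_apply contDiff_const).differentiable (by norm_num)

lemma lap_add (hf : ContDiff ℝ 2 f) (hg : ContDiff ℝ 2 g) (x : EuclideanSpace ℝ (Fin n)) :
    lap (fun y => f y + g y) x = lap f x + lap g x := by
  simp only [lap, ← Finset.sum_add_distrib]
  refine Finset.sum_congr rfl fun i _ => ?_
  have h : (fun y => fderiv ℝ (fun y => f y + g y) y (EuclideanSpace.single i 1))
      = fun y => fderiv ℝ f y (EuclideanSpace.single i 1)
        + fderiv ℝ g y (EuclideanSpace.single i 1) := by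
    funext y
    rw [fderiv_fun_add (hf.differentiable (by norm_num) y) (hg.differentiable (by norm_num) y)]
    rfl
  rw [h, fderiv_fun_add (hf.differentiable_fderiv_apply _ x) (hg.differentiable_fderiv_apply _ x)]
  rfl

lemma lap_const_mul (hf : ContDiff ℝ 2 f) (a : ℝ) (x : EuclideanSpace ℝ (Fin n)) :
    lap (fun y => a * f y) x = a * lap f x := by
  simp only [lap, Finset.mul_sum]
  refine Finset.sum_congr rfl fun i _ => ?_
  have h : (fun y => fderiv ℝ (fun y => a * f y) y (EuclideanSpace.single i 1))
      = fun y => a * fderiv ℝ f y (EuclideanSpace.single i 1) := by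
    funext y
    rw [fderiv_const_mul (hf.differentiable (by norm_num) y)]
    rfl
  rw [h, fderiv_const_mul (hf.differentiable_fderiv_apply _ x)]
  rfl

lemma lap_const (a : ℝ) (x : EuclideanSpace ℝ (Fin n)) : lap (fun _ => a) x = 0 := by
  simp [lap]

lemma lap_norm_sq (x : EuclideanSpace ℝ (Fin n)) : lap (fun y => ‖y‖ ^ 2) x = 2 * n := by
  have h (i : Fin n) :
      (fun y : EuclideanSpace ℝ (Fin n) =>
        fderiv ℝ (fun y : EuclideanSpace ℝ (Fin n) => ‖y‖ ^ 2) y (EuclideanSpace.single i 1))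
      = fun y => ((2 : ℝ) • EuclideanSpace.proj (𝕜 := ℝ) i :
          EuclideanSpace ℝ (Fin n) →L[ℝ] ℝ) y := by
    funext y
    rw [fderiv_norm_sq_apply]
    simp [EuclideanSpace.inner_single_right]
  simp only [lap, h, ContinuousLinearMap.fderiv]
  simp [mul_comm]

/-- The second derivative is nonnegative at a local minimum. -/
lemma IsLocalMin.deriv_deriv_nonneg {h : ℝ → ℝ} {a : ℝ} (hmin : IsLocalMin h a)
    (hc : ContinuousAt h a) : 0 ≤ deriv (deriv h) a := by
  by_contra! hneg
  have hmax := isLocalMax_of_deriv_deriv_neg hneg hmin.deriv_eq_zero hc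
  have hconst : h =ᶠ[nhds a] fun _ => h a := by
    filter_upwards [hmin, hmax] with y h₁ h₂ using le_antisymm h₂ h₁
  have := hconst.deriv.deriv_eq
  simp at this
  linarith

lemma IsLocalMin.lap_nonneg {x : EuclideanSpace ℝ (Fin n)} (hmin : IsLocalMin f x)
    (hf : ContDiff ℝ 2 f) : 0 ≤ lap f x := by
  refine Finset.sum_nonneg fun i _ => ?_
  set e : EuclideanSpace ℝ (Fin n) := EuclideanSpace.single i 1
  have hline (s : ℝ) : HasDerivAt (fun s : ℝ => x + s • e) e s := by
    simpa using ((hasDerivAt_id s).smul_const e).const_add x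
  have hderiv : deriv (fun s : ℝ => f (x + s • e)) = fun s => fderiv ℝ f (x + s • e) e := by
    funext s
    exact ((hf.differentiable (by norm_num) _).hasFDerivAt.comp_hasDerivAt s (hline s)).deriv
  have hderiv₂ : deriv (fun s : ℝ => fderiv ℝ f (x + s • e) e) 0
      = fderiv ℝ (fun y => fderiv ℝ f y e) x e := by
    have := ((hf.differentiable_fderiv_apply e (x + (0 : ℝ) • e)).hasFDerivAt.comp_hasDerivAt 0
      (hline 0)).deriv
    simpa [Function.comp_def] using this
  have hcont : Continuous fun s : ℝ => f (x + s • e) := hf.continuous.comp (by fun_prop)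
  have hmin' : IsLocalMin (fun s : ℝ => f (x + s • e)) 0 := by
    refine IsMinFilter.comp_tendsto (g := fun s : ℝ => x + s • e) (f := f) (l := nhds x) ?_ ?_
    · simpa [IsLocalMin] using hmin
    · simpa using (hline 0).continuousAt.tendsto
  have := hmin'.deriv_deriv_nonneg hcont.continuousAt
  rwa [hderiv, hderiv₂] at this

end Laplacian

/-- At a minimum over `[0, T]` attained at a positive time, the time derivative is nonpositive. -/
lemma HasDerivWithinAt.nonpos_of_isMinOn_Icc {T t d : ℝ} {h : ℝ → ℝ}
    (hd : HasDerivWithinAt h d (Set.Icc 0 T) t) (hmin : IsMinOn h (Set.Icc 0 T) t)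
    (ht : t ∈ Set.Icc 0 T) (ht₀ : 0 < t) : d ≤ 0 := by
  have hseg : segment ℝ t 0 ⊆ Set.Icc 0 T :=
    (convex_Icc 0 T).segment_subset ht ⟨le_rfl, ht.1.trans ht.2⟩
  have := hmin.localize.hasFDerivWithinAt_nonneg hd.hasFDerivWithinAt
    (sub_mem_posTangentConeAt_of_segment_subset hseg)
  simp at this
  nlinarith

/-- Weak minimum principle on `[0, T] × ℝ^n` for supersolutions, bounded below, of
`A ∂_t w = c Δ w - R w` with `A` bounded below by a positive constant and `c, R ≥ 0`. -/
theorem parabolic_minimum_principle {n : ℕ} {T c α m : ℝ} (hc : 0 ≤ c) (hα : 0 < α)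
    {R : EuclideanSpace ℝ (Fin n) → ℝ} (hR : ∀ x, 0 ≤ R x)
    {w w' A : ℝ × EuclideanSpace ℝ (Fin n) → ℝ}
    (hwc : ContinuousOn w (Set.Icc 0 T ×ˢ Set.univ))
    (hwx : ∀ t ∈ Set.Icc 0 T, ContDiff ℝ 2 fun y => w (t, y))
    (hwt : ∀ t ∈ Set.Icc 0 T, ∀ x,
      HasDerivWithinAt (fun s => w (s, x)) (w' (t, x)) (Set.Icc 0 T) t)
    (hA : ∀ t ∈ Set.Icc 0 T, ∀ x, α ≤ A (t, x))
    (hm : ∀ t ∈ Set.Icc 0 T, ∀ x, m ≤ w (t, x))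
    (hsuper : ∀ t ∈ Set.Icc 0 T, ∀ x,
      c * lap (fun y => w (t, y)) x - R x * w (t, x) ≤ A (t, x) * w' (t, x))
    (hinit : ∀ x, 0 ≤ w (0, x)) :
    ∀ t ∈ Set.Icc 0 T, ∀ x, 0 ≤ w (t, x) := by
  intro t₁ ht₁ x₁
  by_contra! hneg
  obtain ⟨K, hK₀, hK⟩ : ∃ K : ℝ, 0 ≤ K ∧ 2 * n * c < α * K := by
    refine ⟨(2 * n * c + 1) / α, by positivity, ?_⟩
    rw [mul_div_cancel₀ _ hα.ne']
    linarith
  set φ : ℝ × EuclideanSpace ℝ (Fin n) → ℝ := fun p => ‖p.2‖ ^ 2 + (K * p.1 + 1) with hφ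
  have hφpos (t : ℝ) (ht : t ∈ Set.Icc 0 T) (x) : 0 < φ (t, x) := by
    have := mul_nonneg hK₀ ht.1
    simp only [hφ]
    positivity
  obtain ⟨ε, hε, hε₁⟩ : ∃ ε > 0, w (t₁, x₁) + ε * φ (t₁, x₁) < 0 := by
    have h := hφpos t₁ ht₁ x₁
    refine ⟨-w (t₁, x₁) / (2 * φ (t₁, x₁)), div_pos (by linarith) (by linarith), ?_⟩
    field_simp
    linarith
  set z : ℝ × EuclideanSpace ℝ (Fin n) → ℝ := fun p => w p + ε * φ p with hz
  have hfar (t : ℝ) (ht : t ∈ Set.Icc 0 T) (x) (hx : |m| / ε + 1 < ‖x‖) : 0 < z (t, x) := by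
    have h₁ : |m| / ε < ‖x‖ ^ 2 := by
      have : 0 ≤ |m| / ε := by positivity
      nlinarith
    rw [div_lt_iff₀ hε] at h₁
    have h₂ := mul_nonneg hε.le (mul_nonneg hK₀ ht.1)
    have h₃ := hm t ht x
    have h₄ := neg_abs_le m
    simp only [hz, hφ]
    nlinarith
  have hx₁ : ‖x₁‖ ≤ |m| / ε + 1 := by
    by_contra! h
    exact (hfar t₁ ht₁ x₁ h).not_gt hε₁
  have hzc : ContinuousOn z (Set.Icc 0 T ×ˢ Set.univ) := by
    refine hwc.add (Continuous.continuousOn ?_)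
    fun_prop
  obtain ⟨⟨t₀, x₀⟩, ⟨ht₀, -⟩, hmin₀⟩ :=
    ((isCompact_Icc (a := (0 : ℝ)) (b := T)).prod
      (isCompact_closedBall (0 : EuclideanSpace ℝ (Fin n)) (|m| / ε + 1))).exists_isMinOn
      ⟨(t₁, x₁), ht₁, by simpa using hx₁⟩
      (hzc.mono (Set.prod_mono_right (Set.subset_univ _)))
  have hz₀ : z (t₀, x₀) < 0 :=
    (hmin₀ (show (t₁, x₁) ∈ _ from ⟨ht₁, by simpa using hx₁⟩)).trans_lt hε₁
  have hmin (t : ℝ) (ht : t ∈ Set.Icc 0 T) (x) : z (t₀, x₀) ≤ z (t, x) := by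
    by_cases hx : ‖x‖ ≤ |m| / ε + 1
    · exact hmin₀ (show (t, x) ∈ _ from ⟨ht, by simpa using hx⟩)
    · exact (hz₀.trans (hfar t ht x (not_le.mp hx))).le
  have ht₀pos : 0 < t₀ := by
    refine lt_of_le_of_ne ht₀.1 ?_
    rintro rfl
    have h₁ := hinit x₀
    have h₂ := mul_pos hε (hφpos 0 ht₀ x₀)
    simp only [hz] at hz₀
    linarith
  have hzt : HasDerivWithinAt (fun s => z (s, x₀)) (w' (t₀, x₀) + ε * K) (Set.Icc 0 T) t₀ := by
    refine (hwt t₀ ht₀ x₀).add (HasDerivAt.hasDerivWithinAt ?_)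
    simpa using (((((hasDerivAt_id t₀).const_mul K).add_const 1).const_add (‖x₀‖ ^ 2)).const_mul ε)
  have htime : w' (t₀, x₀) + ε * K ≤ 0 :=
    hzt.nonpos_of_isMinOn_Icc (fun s hs => hmin s hs x₀) ht₀ ht₀pos
  have hsq : ContDiff ℝ 2 fun y : EuclideanSpace ℝ (Fin n) => ‖y‖ ^ 2 := contDiff_norm_sq ℝ
  have hφx : ContDiff ℝ 2 fun y => φ (t₀, y) :=
    hsq.add (contDiff_const (c := K * t₀ + 1))
  have hlapz : lap (fun y => z (t₀, y)) x₀ = lap (fun y => w (t₀, y)) x₀ + ε * (2 * n) := by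
    have hlapφ : lap (fun y => φ (t₀, y)) x₀ = 2 * n := by
      simp only [hφ]
      rw [lap_add hsq contDiff_const, lap_norm_sq, lap_const, add_zero]
    simp only [hz]
    rw [lap_add (hwx t₀ ht₀) (contDiff_const.mul hφx), lap_const_mul hφx, hlapφ]
  have hspace : 0 ≤ lap (fun y => z (t₀, y)) x₀ := by
    refine IsLocalMin.lap_nonneg (Eventually.of_forall fun y => hmin t₀ ht₀ y) ?_
    exact (hwx t₀ ht₀).add (contDiff_const.mul hφx)
  have hw₀ : w (t₀, x₀) ≤ 0 := by
    have h₂ := mul_pos hε (hφpos t₀ ht₀ x₀)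
    simp only [hz] at hz₀
    linarith
  have h₁ := hsuper t₀ ht₀ x₀
  have h₂ := hA t₀ ht₀ x₀
  have h₃ : c * (-(ε * (2 * n))) ≤ c * lap (fun y => w (t₀, y)) x₀ :=
    mul_le_mul_of_nonneg_left (by linarith) hc
  have h₄ := mul_nonneg (hR x₀) (neg_nonneg.mpr hw₀)
  have h₅ : A (t₀, x₀) * w' (t₀, x₀) ≤ A (t₀, x₀) * (-(ε * K)) :=
    mul_le_mul_of_nonneg_left (by linarith) (hα.le.trans h₂)
  have h₆ : α * (ε * K) ≤ A (t₀, x₀) * (ε * K) := mul_le_mul_of_nonneg_right h₂ (by positivity)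
  have h₇ := mul_lt_mul_of_pos_left hK hε
  nlinarith

/-- Barrier invariance for the Yamabe flow: the class `|u - 1| ≤ C v` is preserved,
where `v` solves `-c_n Δv + R₀ v = R₀`. -/
theorem yamabe_flow_barrier_invariance (n : ℕ) (hn : 3 ≤ n) (T : ℝ) (hT : 0 < T)
    (R₀ : EuclideanSpace ℝ (Fin n) → ℝ) (hR₀c : Continuous R₀) (hR₀ : ∀ x, 0 ≤ R₀ x)
    (hR₀bdd : ∃ B, ∀ x, R₀ x ≤ B)
    (v : EuclideanSpace ℝ (Fin n) → ℝ) (hv : ContDiff ℝ 2 v) (hvbdd : ∃ B, ∀ x, |v x| ≤ B)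
    (hveq : ∀ x, -(4 * ((n : ℝ) - 1) / ((n : ℝ) - 2)) * lap v x + R₀ x * v x = R₀ x)
    (C : ℝ) (hC : 1 ≤ C)
    (u : ℝ × EuclideanSpace ℝ (Fin n) → ℝ)
    (hu : ContDiffOn ℝ (⊤ : ℕ∞) u (Set.Icc 0 T ×ˢ Set.univ))
    (c₁ c₂ : ℝ) (hc₁ : 0 < c₁)
    (hbounds : ∀ t ∈ Set.Icc (0 : ℝ) T, ∀ x, c₁ ≤ u (t, x) ∧ u (t, x) ≤ c₂)
    (hflow : ∀ t ∈ Set.Icc (0 : ℝ) T, ∀ x,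
      (((n : ℝ) + 2) / ((n : ℝ) - 2)) * u (t, x) ^ ((4 : ℝ) / ((n : ℝ) - 2)) *
          derivWithin (fun s => u (s, x)) (Set.Icc 0 T) t
        = (4 * ((n : ℝ) - 1) / ((n : ℝ) - 2)) * lap (fun y => u (t, y)) x - R₀ x * u (t, x)) :
    ((∀ x, 1 - C * v x ≤ u (0, x)) →
        ∀ t ∈ Set.Icc (0 : ℝ) T, ∀ x, 1 - C * v x ≤ u (t, x)) ∧
    ((∀ x, u (0, x) ≤ 1 + C * v x) →
        ∀ t ∈ Set.Icc (0 : ℝ) T, ∀ x, u (t, x) ≤ 1 + C * v x) := by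
  have hn' : (3 : ℝ) ≤ n := by exact_mod_cast hn
  set c : ℝ := 4 * ((n : ℝ) - 1) / ((n : ℝ) - 2)
  have hc : 0 ≤ c := div_nonneg (by linarith) (by linarith)
  have hp : 0 < ((n : ℝ) + 2) / ((n : ℝ) - 2) := div_pos (by linarith) (by linarith)
  have hq : 0 ≤ (4 : ℝ) / ((n : ℝ) - 2) := div_nonneg (by norm_num) (by linarith)
  set p : ℝ := ((n : ℝ) + 2) / ((n : ℝ) - 2)
  set q : ℝ := (4 : ℝ) / ((n : ℝ) - 2)
  have hα : 0 < p * c₁ ^ q := mul_pos hp (Real.rpow_pos_of_pos hc₁ q)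
  have hA : ∀ t ∈ Set.Icc 0 T, ∀ x, p * c₁ ^ q ≤ p * u (t, x) ^ q := fun t ht x =>
    mul_le_mul_of_nonneg_left (Real.rpow_le_rpow hc₁.le (hbounds t ht x).1 hq) hp.le
  obtain ⟨B, hB⟩ := hvbdd
  have hCv (x) : |C * v x| ≤ C * B := by
    rw [abs_mul, abs_of_nonneg (by linarith)]
    exact mul_le_mul_of_nonneg_left (hB x) (by linarith)
  have hux : ∀ t ∈ Set.Icc 0 T, ContDiff ℝ 2 fun y => u (t, y) := fun t ht => by
    rw [← contDiffOn_univ]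
    exact (hu.of_le (WithTop.coe_le_coe.mpr le_top)).comp
      (contDiff_prodMk_right t).contDiffOn fun y _ => ⟨ht, Set.mem_univ y⟩
  have hut : ∀ t ∈ Set.Icc 0 T, ∀ x, HasDerivWithinAt (fun s => u (s, x))
      (derivWithin (fun s => u (s, x)) (Set.Icc 0 T) t) (Set.Icc 0 T) t := fun t ht x => by
    refine DifferentiableWithinAt.hasDerivWithinAt ?_
    exact (hu.differentiableOn (by simp)).comp (g := u)
      ((contDiff_prodMk_left x).differentiable one_ne_zero).differentiableOn
      (fun s hs => ⟨hs, Set.mem_univ x⟩) t ht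
  have hb (a : ℝ) : ContDiff ℝ 2 fun y => a * v y := contDiff_const.mul hv
  have hvc : Continuous v := hv.continuous
  constructor
  · intro h0 t ht x
    have := parabolic_minimum_principle (T := T) (m := c₁ + (-1 - C * B)) hc hα hR₀
      (w := fun z => u z + (-1 + C * v z.2))
      (w' := fun z => derivWithin (fun s => u (s, z.2)) (Set.Icc 0 T) z.1)
      (A := fun z => p * u z ^ q)
      (hu.continuousOn.add (Continuous.continuousOn (by fun_prop)))
      (fun t ht => (hux t ht).add (contDiff_const.add (hb C)))
      (fun t ht x => (hut t ht x).add_const (-1 + C * v x)) hA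
      (fun t ht x => by
        have h₁ := (hbounds t ht x).1
        have h₂ := neg_le_of_abs_le (hCv x)
        linarith)
      (fun t ht x => by
        dsimp only
        rw [hflow t ht x, lap_add (hux t ht) (contDiff_const.add (hb C)),
          lap_add contDiff_const (hb C), lap_const, lap_const_mul hv]
        have h₁ := congrArg (C * ·) (hveq x)
        have h₂ := mul_nonneg (hR₀ x) (sub_nonneg.mpr hC)
        linarith)
      (fun x => by
        have := h0 x
        dsimp only
        linarith) t ht x
    dsimp only at this
    linarith
  · intro h0 t ht x
    have := parabolic_minimum_principle (T := T) (m := -c₂ + (1 - C * B)) hc hα hR₀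
      (w := fun z => -1 * u z + (1 + C * v z.2))
      (w' := fun z => -1 * derivWithin (fun s => u (s, z.2)) (Set.Icc 0 T) z.1)
      (A := fun z => p * u z ^ q)
      ((continuousOn_const.mul hu.continuousOn).add (Continuous.continuousOn (by fun_prop)))
      (fun t ht => (contDiff_const.mul (hux t ht)).add (contDiff_const.add (hb C)))
      (fun t ht x => ((hut t ht x).const_mul (-1)).add_const (1 + C * v x)) hA
      (fun t ht x => by
        have h₁ := (hbounds t ht x).2
        have h₂ := neg_le_of_abs_le (hCv x)
        linarith)
      (fun t ht x => by
        dsimp only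
        rw [lap_add (contDiff_const.mul (hux t ht)) (contDiff_const.add (hb C)),
          lap_add contDiff_const (hb C), lap_const, lap_const_mul hv, lap_const_mul (hux t ht)]
        have h₀ := hflow t ht x
        have h₁ := congrArg (C * ·) (hveq x)
        have h₂ := mul_nonneg (hR₀ x) (by linarith : 0 ≤ C + 1)
        linarith)
      (fun x => by
        have := h0 x
        dsimp only
        linarith) t ht x
    dsimp only at this
    linarith
end

section
/- Let n ≥ 3, m := (n−2)/(n+2), c_n := 4(n−1)/(n−2), and T > 0. Let u, v : [0,T] × ℝ^n → ℝ be smooth positive functions satisfying the fast-diffusion (Yamabe flow) equation ∂_t u = c_n Δ_x (u^m) and ∂_t v = c_n Δ_x (v^m) on [0,T] × ℝ^n, and suppose there is R₀ > 0 such that u(t,x) = v(t,x) whenever ‖x‖ ≥ R₀ (for all t ∈ [0,T]). Let ψ : ℝ^n → ℝ be smooth and compactly supported with 0 ≤ ψ ≤ 1, and suppose C(ψ) := (∫_{{ψ>0}} |Δψ|^{1/(1−m)} ψ^{−m/(1−m)} dx)^{1−m} is finite. Then for all 0 ≤ s ≤ t ≤ T: (∫_{ℝ^n} |u(t,x) −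 v(t,x)| ψ(x) dx)^{1−m} ≤ (∫_{ℝ^n} |u(s,x) − v(s,x)| ψ(x) dx)^{1−m} + (1−m) c_n C(ψ) (t − s). -/
open Filter MeasureTheory

open scoped Topology ContDiff

section Directional

variable {E : Type*} [NormedAddCommGroup E] [NormedSpace ℝ E]

/-- Directional derivatives of smooth functions are smooth. -/
lemma ContDiff.fderiv_apply_const {f : E → ℝ} (hf : ContDiff ℝ ∞ f) (e : E) :
    ContDiff ℝ ∞ (fun x => fderiv ℝ f x e) :=
  (hf.fderiv_right (m := ∞) (by simp)).clm_apply contDiff_const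

/-- Second directional derivative of a composition with a real function. -/
lemma fderiv_fderiv_comp_apply {W : E → ℝ} (hW : ContDiff ℝ ∞ W) {j j' j'' : ℝ → ℝ}
    (hj : ∀ r, HasDerivAt j (j' r) r) (hj' : ∀ r, HasDerivAt j' (j'' r) r) (x e : E) :
    fderiv ℝ (fun y => fderiv ℝ (fun z => j (W z)) y e) x e =
      j'' (W x) * fderiv ℝ W x e ^ 2 + j' (W x) * fderiv ℝ (fun y => fderiv ℝ W y e) x e := by
  have hWd : ∀ y, HasFDerivAt W (fderiv ℝ W y) y := fun y =>
    (hW.differentiable (by simp) y).hasFDerivAt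
  have h1 : (fun y => fderiv ℝ (fun z => j (W z)) y e) = fun y => j' (W y) * fderiv ℝ W y e := by
    funext y
    have := (hj (W y)).comp_hasFDerivAt y (hWd y)
    rw [show (fun z => j (W z)) = j ∘ W from rfl, this.fderiv]
    simp
  rw [h1]
  have h2 := (hj' (W x)).comp_hasFDerivAt x (hWd x)
  have h3 : HasFDerivAt (fun y => fderiv ℝ W y e) (fderiv ℝ (fun y => fderiv ℝ W y e) x) x :=
    ((hW.fderiv_apply_const e).differentiable (by simp) x).hasFDerivAt
  have h4 := h2.mul h3
  rw [show (fun y => j' (W y) * fderiv ℝ W y e) = (j' ∘ W) * (fun y => fderiv ℝ W y e) from rfl,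
    h4.fderiv]
  simp
  ring

variable [FiniteDimensional ℝ E] [MeasurableSpace E] [BorelSpace E]

/-- The derivative of a function vanishes almost everywhere on a set where the function vanishes. -/
lemma ae_fderiv_eq_zero_of_eqOn_zero (μ : Measure E) [μ.IsAddHaarMeasure] {g : E → ℝ}
    (hg : Differentiable ℝ g) {s : Set E} (hs : MeasurableSet s) (h0 : ∀ x ∈ s, g x = 0) {e : E}
    (he : e ≠ 0) : ∀ᵐ x ∂μ, x ∈ s → fderiv ℝ g x = 0 := by
  have happ : ApproximatesLinearOn (fun x => g x • e) (0 : E →L[ℝ] E) s 0 := by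
    intro x hx y hy
    simp [h0 x hx, h0 y hy]
  have := happ.norm_fderiv_sub_le μ hs (fun x => (fderiv ℝ g x).smulRight e)
    (fun x _ => ((hg x).hasFDerivAt.smul_const e).hasFDerivWithinAt)
  rw [ae_restrict_iff' hs] at this
  filter_upwards [this] with x hx hxs
  simpa [he] using hx hxs

/-- Integration by parts for directional derivatives against a compactly supported function. -/
lemma integral_fderiv_mul_eq_neg (μ : Measure E) [μ.IsAddHaarMeasure] {f g : E → ℝ}
    (hf : ContDiff ℝ ∞ f) (hg : ContDiff ℝ ∞ g) (hgc : HasCompactSupport g) (e : E) :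
    ∫ x, fderiv ℝ f x e * g x ∂μ = - ∫ x, f x * fderiv ℝ g x e ∂μ := by
  have h1 := (hf.fderiv_apply_const e).continuous
  have h2 := (hg.fderiv_apply_const e).continuous
  have h3 : HasCompactSupport (fun x => fderiv ℝ g x e) := hgc.fderiv_apply ℝ e
  rw [integral_mul_fderiv_eq_neg_fderiv_mul_of_integrable, neg_neg]
  · exact (h1.mul hg.continuous).integrable_of_hasCompactSupport hgc.mul_left
  · exact (hf.continuous.mul h2).integrable_of_hasCompactSupport h3.mul_left
  · exact (hf.continuous.mul hg.continuous).integrable_of_hasCompactSupport hgc.mul_left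
  · exact fun x _ => hf.differentiable (by simp) x
  · exact fun x _ => hg.differentiable (by simp) x

end Directional

section Laplacian

variable {n : ℕ}

lemma ContDiff.lap {f : EuclideanSpace ℝ (Fin n) → ℝ}
    (hf : ContDiff ℝ ∞ f) : ContDiff ℝ ∞ (lap f) :=
  ContDiff.sum fun _ _ => (hf.fderiv_apply_const _).fderiv_apply_const _

lemma HasCompactSupport.lap {f : EuclideanSpace ℝ (Fin n) → ℝ} (hf : HasCompactSupport f) :
    HasCompactSupport (lap f) := by
  refine HasCompactSupport.of_support_subset_isCompact hf ?_
  intro x hx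
  by_contra hxs
  refine hx (Finset.sum_eq_zero fun i _ => ?_)
  have h1 : tsupport (fun y => fderiv ℝ (fun z => fderiv ℝ f z (EuclideanSpace.single i 1)) y
      (EuclideanSpace.single i 1)) ⊆ tsupport f :=
    (tsupport_fderiv_apply_subset ℝ _).trans (tsupport_fderiv_apply_subset ℝ _)
  exact image_eq_zero_of_notMem_tsupport (f := fun y => fderiv ℝ (fun z => fderiv ℝ f z
    (EuclideanSpace.single i 1)) y (EuclideanSpace.single i 1)) (fun h => hxs (h1 h))

lemma lap_sub {f g : EuclideanSpace ℝ (Fin n) → ℝ}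
    (hf : ContDiff ℝ ∞ f) (hg : ContDiff ℝ ∞ g) (x : EuclideanSpace ℝ (Fin n)) :
    lap (fun y => f y - g y) x = lap f x - lap g x := by
  simp only [lap, ← Finset.sum_sub_distrib]
  refine Finset.sum_congr rfl fun i _ => ?_
  have : (fun y => fderiv ℝ (fun z => f z - g z) y (EuclideanSpace.single i 1)) =
      fun y => fderiv ℝ f y (EuclideanSpace.single i 1) -
        fderiv ℝ g y (EuclideanSpace.single i 1) := by
    funext y
    rw [fderiv_fun_sub (hf.differentiable (by simp) y) (hg.differentiable (by simp) y)]
    rfl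
  rw [this, fderiv_fun_sub ((hf.fderiv_apply_const _).differentiable (by simp) x)
    ((hg.fderiv_apply_const _).differentiable (by simp) x)]
  rfl

/-- Green's identity against a compactly supported function. -/
lemma integral_lap_mul {f g : EuclideanSpace ℝ (Fin n) → ℝ}
    (hf : ContDiff ℝ ∞ f) (hg : ContDiff ℝ ∞ g)
    (hgc : HasCompactSupport g) : ∫ x, lap f x * g x = ∫ x, f x * lap g x := by
  simp only [lap, Finset.sum_mul, Finset.mul_sum]
  rw [integral_finsetSum, integral_finsetSum]
  · refine Finset.sum_congr rfl fun i _ => ?_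
    rw [integral_fderiv_mul_eq_neg _ (hf.fderiv_apply_const _) hg hgc,
      integral_fderiv_mul_eq_neg _ hf (hg.fderiv_apply_const _) (hgc.fderiv_apply ℝ _), neg_neg]
  · intro i _
    have h := ((hg.fderiv_apply_const (EuclideanSpace.single i 1)).fderiv_apply_const
      (EuclideanSpace.single i 1)).continuous
    refine (hf.continuous.mul h).integrable_of_hasCompactSupport ?_
    exact ((hgc.fderiv_apply ℝ _).fderiv_apply ℝ _).mul_left
  · intro i _
    exact (((hf.fderiv_apply_const _).fderiv_apply_const _).continuous.mul
      hg.continuous).integrable_of_hasCompactSupport hgc.mul_left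

/-- Convex functions of `W` satisfy `j'(W) ΔW ≤ Δ(j(W))`. -/
lemma deriv_mul_lap_le_lap_comp {W : EuclideanSpace ℝ (Fin n) → ℝ}
    (hW : ContDiff ℝ ∞ W) {j j' j'' : ℝ → ℝ}
    (hj : ∀ r, HasDerivAt j (j' r) r) (hj' : ∀ r, HasDerivAt j' (j'' r) r)
    (hj'' : ∀ r, 0 ≤ j'' r) (x : EuclideanSpace ℝ (Fin n)) :
    j' (W x) * lap W x ≤ lap (fun y => j (W y)) x := by
  simp only [lap, Finset.mul_sum]
  refine Finset.sum_le_sum fun i _ => ?_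
  rw [fderiv_fderiv_comp_apply hW hj hj']
  have := mul_nonneg (hj'' (W x)) (sq_nonneg (fderiv ℝ W x (EuclideanSpace.single i 1)))
  linarith

lemma hasDerivAt_sqrt_sq_add {ε : ℝ} (hε : 0 < ε) (r : ℝ) :
    HasDerivAt (fun s => √(s ^ 2 + ε)) (r / √(r ^ 2 + ε)) r := by
  have h : 0 < r ^ 2 + ε := by positivity
  refine (((hasDerivAt_pow 2 r).add_const ε).sqrt h.ne').congr_deriv ?_
  have := Real.sqrt_pos.2 h
  field_simp
  simp [mul_comm]

lemma hasDerivAt_div_sqrt_sq_add {ε : ℝ} (hε : 0 < ε) (r : ℝ) :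
    HasDerivAt (fun s => s / √(s ^ 2 + ε)) (ε / √(r ^ 2 + ε) ^ 3) r := by
  have h : 0 < r ^ 2 + ε := by positivity
  have h' := Real.sqrt_pos.2 h
  refine ((hasDerivAt_id' r).div (hasDerivAt_sqrt_sq_add hε r) h'.ne').congr_deriv ?_
  have hsq := Real.sq_sqrt h.le
  generalize √(r ^ 2 + ε) = S at h' hsq ⊢
  rw [eq_sub_of_add_eq' hsq.symm]
  field_simp

lemma abs_div_sqrt_sq_add_le_one {ε : ℝ} (hε : 0 < ε) (r : ℝ) : |r / √(r ^ 2 + ε)| ≤ 1 := by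
  have h : 0 < r ^ 2 + ε := by positivity
  rw [abs_div, abs_of_pos (Real.sqrt_pos.2 h), div_le_one (Real.sqrt_pos.2 h)]
  exact Real.abs_le_sqrt (by linarith)

lemma tendsto_sqrt_sq_add (r : ℝ) :
    Tendsto (fun ε => √(r ^ 2 + ε)) (𝓝[>] 0) (𝓝 |r|) := by
  have : Continuous fun ε : ℝ => √(r ^ 2 + ε) := by fun_prop
  have h := (this.tendsto 0).mono_left (nhdsWithin_le_nhds (s := Set.Ioi 0))
  simpa [Real.sqrt_sq_eq_abs] using h

lemma Real.div_abs_eq_sign (r : ℝ) : r / |r| = Real.sign r := by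
  rcases lt_trichotomy r 0 with h | h | h
  · rw [Real.sign_of_neg h, abs_of_neg h, div_neg, div_self h.ne]
  · simp [h]
  · rw [Real.sign_of_pos h, abs_of_pos h, div_self h.ne']

lemma tendsto_div_sqrt_sq_add (r : ℝ) :
    Tendsto (fun ε => r / √(r ^ 2 + ε)) (𝓝[>] 0) (𝓝 (Real.sign r)) := by
  rcases eq_or_ne r 0 with rfl | hr
  · simp
  · rw [← Real.div_abs_eq_sign]
    exact tendsto_const_nhds.div (tendsto_sqrt_sq_add r) (abs_ne_zero.2 hr)

/-- Kato's inequality in integrated form. -/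
lemma integral_sign_mul_lap_mul_le {W ψ : EuclideanSpace ℝ (Fin n) → ℝ}
    (hW : ContDiff ℝ ∞ W) (hψ : ContDiff ℝ ∞ ψ)
    (hψc : HasCompactSupport ψ) (hψ0 : ∀ x, 0 ≤ ψ x) :
    ∫ x, Real.sign (W x) * lap W x * ψ x ≤ ∫ x, |W x| * lap ψ x := by
  have hW2 : ∀ ε : ℝ, 0 < ε → ∀ x, 0 < W x ^ 2 + ε := fun ε hε x => by positivity
  have hWc := hW.continuous
  have hlW := hW.lap.continuous
  have hψc' := hψ.continuous
  have hlψ := hψ.lap.continuous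
  have hc : ∀ ε : ℝ, 0 < ε → Continuous fun x => W x / √(W x ^ 2 + ε) := fun ε hε =>
    hWc.div (by fun_prop) fun x => (Real.sqrt_pos.2 (hW2 ε hε x)).ne'
  have hL : Tendsto (fun ε => ∫ x, W x / √(W x ^ 2 + ε) * lap W x * ψ x) (𝓝[>] 0)
      (𝓝 (∫ x, Real.sign (W x) * lap W x * ψ x)) := by
    refine tendsto_integral_filter_of_dominated_convergence (fun x => |lap W x * ψ x|) ?_ ?_ ?_ ?_
    · filter_upwards [self_mem_nhdsWithin] with ε hε
      exact (((hc ε hε).mul hlW).mul hψc').aestronglyMeasurable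
    · filter_upwards [self_mem_nhdsWithin] with ε hε
      refine ae_of_all _ fun x => ?_
      rw [mul_assoc, Real.norm_eq_abs, abs_mul]
      exact mul_le_of_le_one_left (abs_nonneg _) (abs_div_sqrt_sq_add_le_one hε _)
    · exact ((hlW.mul hψc').integrable_of_hasCompactSupport hψc.mul_left).abs
    · exact ae_of_all _ fun x => ((tendsto_div_sqrt_sq_add _).mul_const _).mul_const _
  have hR : Tendsto (fun ε => ∫ x, √(W x ^ 2 + ε) * lap ψ x) (𝓝[>] 0)
      (𝓝 (∫ x, |W x| * lap ψ x)) := by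
    refine tendsto_integral_filter_of_dominated_convergence
      (fun x => |√(W x ^ 2 + 1) * lap ψ x|) ?_ ?_ ?_ ?_
    · refine Eventually.of_forall fun ε => Continuous.aestronglyMeasurable ?_
      fun_prop
    · filter_upwards [Ioo_mem_nhdsGT (zero_lt_one (α := ℝ))] with ε hε
      refine ae_of_all _ fun x => ?_
      rw [Real.norm_eq_abs, abs_mul, abs_mul, abs_of_nonneg (Real.sqrt_nonneg _),
        abs_of_nonneg (Real.sqrt_nonneg _)]
      gcongr
      exact hε.2.le
    · have h : Continuous fun x => √(W x ^ 2 + 1) * lap ψ x := by fun_prop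
      exact (h.integrable_of_hasCompactSupport hψc.lap.mul_left).abs
    · exact ae_of_all _ fun x => (tendsto_sqrt_sq_add _).mul_const _
  refine le_of_tendsto_of_tendsto hL hR ?_
  filter_upwards [self_mem_nhdsWithin] with ε hε
  have hG : ContDiff ℝ ∞ fun x => √(W x ^ 2 + ε) :=
    ((hW.pow 2).add contDiff_const).sqrt fun x => (hW2 ε hε x).ne'
  rw [← integral_lap_mul hG hψ hψc]
  refine integral_mono ?_ ?_ fun x => ?_
  · exact (((hc ε hε).mul hlW).mul hψc').integrable_of_hasCompactSupport hψc.mul_left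
  · exact (hG.lap.continuous.mul hψc').integrable_of_hasCompactSupport hψc.mul_left
  · refine mul_le_mul_of_nonneg_right ?_ (hψ0 x)
    refine deriv_mul_lap_le_lap_comp hW (hasDerivAt_sqrt_sq_add hε)
      (hasDerivAt_div_sqrt_sq_add hε) (fun r => ?_) x
    have : (0 : ℝ) < ε := hε
    positivity

/-- The Laplacian of a nonnegative function vanishes almost everywhere on the zero set. -/
lemma ae_lap_eq_zero_of_eq_zero {ψ : EuclideanSpace ℝ (Fin n) → ℝ}
    (hψ : ContDiff ℝ ∞ ψ) (hψ0 : ∀ x, 0 ≤ ψ x) :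
    ∀ᵐ x, ψ x = 0 → lap ψ x = 0 := by
  have hmeas : MeasurableSet {x | ψ x = 0} :=
    hψ.continuous.measurable (measurableSet_singleton 0)
  have key : ∀ i : Fin n, ∀ᵐ x, ψ x = 0 →
      fderiv ℝ (fun y => fderiv ℝ ψ y (EuclideanSpace.single i 1)) x = 0 := fun i =>
    ae_fderiv_eq_zero_of_eqOn_zero volume ((hψ.fderiv_apply_const _).differentiable (by simp))
      hmeas (fun x (hx : ψ x = 0) => by
        have : IsLocalMin ψ x := Eventually.of_forall fun y => hx ▸ hψ0 y
        simp [this.fderiv_eq_zero]) (e := EuclideanSpace.single i 1) (by simp)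
  filter_upwards [ae_all_iff.2 key] with x hx hx0
  exact Finset.sum_eq_zero fun i _ => by simp [hx i hx0]

end Laplacian

section RealInequalities

lemma abs_rpow_sub_rpow_le {m a b : ℝ} (hm0 : 0 ≤ m) (hm1 : m ≤ 1) (ha : 0 ≤ a) (hb : 0 ≤ b) :
    |a ^ m - b ^ m| ≤ |a - b| ^ m := by
  wlog hab : b ≤ a generalizing a b
  · rw [abs_sub_comm, abs_sub_comm a]
    exact this hb ha (le_of_not_ge hab)
  rw [abs_of_nonneg (sub_nonneg.2 (Real.rpow_le_rpow hb hab hm0)),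
    abs_of_nonneg (sub_nonneg.2 hab)]
  have := Real.rpow_add_le_add_rpow (sub_nonneg.2 hab) hb hm0 hm1
  rw [sub_add_cancel] at this
  linarith

lemma sign_rpow_sub_rpow {m a b : ℝ} (hm : 0 < m) (ha : 0 ≤ a) (hb : 0 ≤ b) :
    Real.sign (a ^ m - b ^ m) = Real.sign (a - b) := by
  rcases lt_trichotomy a b with h | h | h
  · rw [Real.sign_of_neg (sub_neg.2 (Real.rpow_lt_rpow ha h hm)), Real.sign_of_neg (sub_neg.2 h)]
  · simp [h]
  · rw [Real.sign_of_pos (sub_pos.2 (Real.rpow_lt_rpow hb h hm)), Real.sign_of_pos (sub_pos.2 h)]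

lemma Real.sign_mul_self_eq_abs (r : ℝ) : Real.sign r * r = |r| := by
  rw [← Real.div_abs_eq_sign, div_mul_eq_mul_div, ← abs_mul_abs_self, mul_self_div_self]

lemma Real.abs_sign_le_one (r : ℝ) : |Real.sign r| ≤ 1 := by
  rcases Real.sign_apply_eq r with h | h | h <;> simp [h]

lemma Real.measurable_sign : Measurable Real.sign :=
  Measurable.ite measurableSet_Iio measurable_const
    (Measurable.ite measurableSet_Ioi measurable_const measurable_const)

/-- Comparison for the differential inequality `f' ≤ K f ^ m`, with `f'` a left Dini derivative. -/
lemma rpow_one_sub_le_of_left_slope_le {f : ℝ → ℝ} {s t m K : ℝ} (hst : s ≤ t) (hm1 : m < 1)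
    (hK : 0 ≤ K) (hf0 : ∀ τ, 0 ≤ f τ) (hf : ContinuousOn f (Set.Icc s t))
    (hslope : ∀ τ ∈ Set.Ioc s t, ∀ r, K * f τ ^ m < r → ∀ᶠ z in 𝓝[<] τ, slope f τ z < r) :
    f t ^ (1 - m) ≤ f s ^ (1 - m) + (1 - m) * K * (t - s) := by
  have hp : 0 < 1 - m := by linarith
  by_contra! hlt
  obtain ⟨L, hL, hLlt⟩ : ∃ L, (1 - m) * K < L ∧ f s ^ (1 - m) + L * (t - s) < f t ^ (1 - m) := by
    have hcont : Continuous fun L : ℝ => f s ^ (1 - m) + L * (t - s) := by fun_prop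
    have h1 := (hcont.tendsto ((1 - m) * K)).eventually_lt_const hlt
    have h2 : ∀ᶠ L in 𝓝[>] ((1 - m) * K), f s ^ (1 - m) + L * (t - s) < f t ^ (1 - m) :=
      h1.filter_mono nhdsWithin_le_nhds
    obtain ⟨L, hL⟩ := (h2.and self_mem_nhdsWithin).exists
    exact ⟨L, hL.2, hL.1⟩
  have hL0 : 0 ≤ L := (mul_nonneg hp.le hK).trans hL.le
  have hfs : 0 ≤ f s ^ (1 - m) := Real.rpow_nonneg (hf0 s) _
  set a := f t ^ (1 - m) with ha
  set p := 1 / (1 - m) with hpdef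
  have hpp : 0 < p := by positivity
  have hy : ∀ x ∈ Set.Icc s t, 0 < a - L * (x - s) := fun x hx => by
    have : L * (x - s) ≤ L * (t - s) := by gcongr; exact hx.2
    linarith
  have hB : ∀ x ∈ Set.Icc s t, HasDerivAt (fun x => -(a - L * (x - s)) ^ p)
      (L * p * (a - L * (x - s)) ^ (p - 1)) x := fun x hx => by
    have h1 : HasDerivAt (fun x => a - L * (x - s)) (-L) x := by
      simpa using (((hasDerivAt_id' x).sub_const s).const_mul L).const_sub a
    refine ((h1.rpow_const (p := p) (Or.inl (hy x hx).ne')).neg).congr_deriv (by ring)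
  have hrefl : ∀ x ∈ Set.Icc s t, s + t - x ∈ Set.Icc s t := fun x hx =>
    ⟨by linarith [hx.2], by linarith [hx.1]⟩
  have key := image_le_of_liminf_slope_right_lt_deriv_boundary' (a := s) (b := t)
    (f := fun x => -f (s + t - x)) (f' := fun x => K * f (s + t - x) ^ m)
    (B := fun x => -(a - L * (x - s)) ^ p)
    (B' := fun x => L * p * (a - L * (x - s)) ^ (p - 1))
    (hf.comp (by fun_prop) hrefl).neg ?_ ?_
    (fun x hx => (hB x hx).continuousAt.continuousWithinAt)
    (fun x hx => (hB x ⟨hx.1, hx.2.le⟩).hasDerivWithinAt) ?_ (Set.right_mem_Icc.2 hst)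
  · simp only [add_sub_cancel_right] at key
    have h1 : f s = (f s ^ (1 - m)) ^ p := by
      rw [← Real.rpow_mul (hf0 s), hpdef, mul_one_div_cancel hp.ne', Real.rpow_one]
    have h2 : (f s ^ (1 - m)) ^ p < (a - L * (t - s)) ^ p :=
      Real.rpow_lt_rpow hfs (by linarith) hpp
    linarith
  · intro x hx r hr
    have h1 := hslope (s + t - x) ⟨by linarith [hx.2], by linarith [hx.1]⟩ r hr
    have h2 : Tendsto (fun z => s + t - z) (𝓝[>] x) (𝓝[<] (s + t - x)) := by
      refine tendsto_nhdsWithin_of_tendsto_nhds_of_eventually_within _ ?_ ?_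
      · have : Continuous fun z : ℝ => s + t - z := by fun_prop
        exact (this.tendsto x).mono_left nhdsWithin_le_nhds
      · filter_upwards [self_mem_nhdsWithin] with z hz
        have : x < z := hz
        exact Set.mem_Iio.2 (by linarith)
    refine ((h2.eventually h1).mono fun z hz => ?_).frequently
    convert hz using 1
    simp only [slope_def_field]
    rw [show s + t - z - (s + t - x) = -(z - x) by ring, div_neg, ← neg_div]
    ring_nf
  · simp only [add_sub_cancel_left, sub_self, mul_zero, sub_zero]
    rw [ha, ← Real.rpow_mul (hf0 t), hpdef, mul_one_div_cancel hp.ne', Real.rpow_one]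
  · intro x hx hxe
    have hyx := hy x ⟨hx.1, hx.2.le⟩
    have h1 : f (s + t - x) = (a - L * (x - s)) ^ p := neg_injective hxe
    have h2 : p * m = p - 1 := by rw [hpdef]; field_simp; ring
    rw [h1, ← Real.rpow_mul hyx.le, h2]
    refine mul_lt_mul_of_pos_right ?_ (Real.rpow_pos_of_pos hyx _)
    rw [hpdef, mul_one_div, lt_div_iff₀ hp]
    linarith

end RealInequalities

section Integrals

variable {X : Type*} [MeasurableSpace X] {μ : Measure X}

/-- The left Dini derivative of `t ↦ ∫ |w t| ψ` is controlled by `∫ sign w ∂ₜw ψ`. -/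
lemma eventually_slope_integral_abs_mul_lt {w w' : ℝ → X → ℝ} {ψ : X → ℝ} {a b M : ℝ}
    (hw : ∀ t ∈ Set.Icc a b, AEStronglyMeasurable (w t) μ)
    (hint : ∀ t ∈ Set.Icc a b, Integrable (fun x => |w t x| * ψ x) μ)
    (hψ : Integrable ψ μ) (hψ0 : ∀ x, 0 ≤ ψ x)
    (hderiv : ∀ t ∈ Set.Icc a b, ∀ x,
      HasDerivWithinAt (fun s => w s x) (w' t x) (Set.Icc a b) t)
    (hbound : ∀ t ∈ Set.Icc a b, ∀ x, ψ x ≠ 0 → |w' t x| ≤ M)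
    {τ : ℝ} (hτ : τ ∈ Set.Ioc a b) {r : ℝ}
    (hr : ∫ x, Real.sign (w τ x) * w' τ x * ψ x ∂μ < r) :
    ∀ᶠ z in 𝓝[<] τ, slope (fun t => ∫ x, |w t x| * ψ x ∂μ) τ z < r := by
  have hτ' : τ ∈ Set.Icc a b := ⟨hτ.1.le, hτ.2⟩
  have hnear : ∀ᶠ z in 𝓝[<] τ, z ∈ Set.Icc a b ∧ z < τ := by
    filter_upwards [Ioo_mem_nhdsLT hτ.1] with z hz
    exact ⟨⟨hz.1.le, hz.2.le.trans hτ.2⟩, hz.2⟩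
  have hmeas : ∀ z ∈ Set.Icc a b, AEStronglyMeasurable
      (fun x => Real.sign (w τ x) * slope (fun t => w t x) τ z * ψ x) μ := fun z hz => by
    have h1 : AEStronglyMeasurable (fun x => Real.sign (w τ x)) μ :=
      (Real.measurable_sign.comp_aemeasurable (hw τ hτ').aemeasurable).aestronglyMeasurable
    simp only [slope_def_field, div_eq_mul_inv]
    exact (h1.mul (((hw z hz).sub (hw τ hτ')).mul_const _)).mul hψ.aestronglyMeasurable
  have hle : ∀ z ∈ Set.Icc a b, z ≠ τ → ∀ x,
      ‖Real.sign (w τ x) * slope (fun t => w t x) τ z * ψ x‖ ≤ M * ψ x := fun z hz hzτ x => by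
    rcases eq_or_ne (ψ x) 0 with h0 | h0
    · simp [h0]
    rw [norm_mul, norm_mul, Real.norm_of_nonneg (hψ0 x)]
    refine mul_le_mul_of_nonneg_right ?_ (hψ0 x)
    have h1 := (convex_Icc a b).norm_image_sub_le_of_norm_hasDerivWithin_le
      (fun t ht => hderiv t ht x) (fun t ht => hbound t ht x h0) hτ' hz
    have h2 : ‖slope (fun t => w t x) τ z‖ ≤ M := by
      rw [slope_def_field, norm_div, div_le_iff₀ (norm_pos_iff.2 (sub_ne_zero.2 hzτ))]
      exact h1
    exact (mul_le_of_le_one_left (norm_nonneg _) (Real.abs_sign_le_one _)).trans h2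
  have hlim : Tendsto (fun z => ∫ x, Real.sign (w τ x) * slope (fun t => w t x) τ z * ψ x ∂μ)
      (𝓝[<] τ) (𝓝 (∫ x, Real.sign (w τ x) * w' τ x * ψ x ∂μ)) := by
    refine tendsto_integral_filter_of_dominated_convergence (fun x => M * ψ x) ?_ ?_
      (hψ.const_mul M) ?_
    · exact hnear.mono fun z hz => hmeas z hz.1
    · exact hnear.mono fun z hz => ae_of_all _ (hle z hz.1 hz.2.ne)
    · refine ae_of_all _ fun x => ?_
      have h1 := hasDerivWithinAt_iff_tendsto_slope.1 (hderiv τ hτ' x)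
      have h2 : 𝓝[<] τ ≤ 𝓝[Set.Icc a b \ {τ}] τ :=
        le_inf nhdsWithin_le_nhds (le_principal_iff.2 (hnear.mono fun z hz => ⟨hz.1, hz.2.ne⟩))
      exact ((h1.mono_left h2).const_mul _).mul_const _
  filter_upwards [hnear, hlim.eventually_lt_const hr] with z hz hzr
  refine lt_of_le_of_lt ?_ hzr
  have hpos : 0 < τ - z := sub_pos.2 hz.2
  rw [slope_comm, slope_def_field, ← integral_sub (hint τ hτ') (hint z hz.1), ← integral_div]
  refine integral_mono (((hint τ hτ').sub (hint z hz.1)).div_const _)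
    ((hψ.const_mul M).mono' (hmeas z hz.1) (ae_of_all _ (hle z hz.1 hz.2.ne))) fun x => ?_
  simp only
  rw [← sub_mul, mul_div_right_comm]
  refine mul_le_mul_of_nonneg_right ?_ (hψ0 x)
  rw [slope_comm, slope_def_field, ← mul_div_assoc]
  gcongr
  rw [mul_sub, Real.sign_mul_self_eq_abs]
  have : Real.sign (w τ x) * w z x ≤ |w z x| :=
    (le_abs_self _).trans (by
      rw [abs_mul]
      exact mul_le_of_le_one_left (abs_nonneg _) (Real.abs_sign_le_one _))
  linarith

/-- Weighted Hölder inequality with exponents `1 / m` and `1 / (1 - m)`. -/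
lemma setIntegral_rpow_mul_le {w h ψ : X → ℝ} {m : ℝ} (hm0 : 0 < m) (hm1 : m < 1)
    (hψ : Measurable ψ) (hψ0 : ∀ x, 0 ≤ ψ x) (hh : Measurable h)
    (hw0 : ∀ x, 0 ≤ w x) (hwψ : Integrable (fun x => w x * ψ x) μ)
    (hint : IntegrableOn (fun x => |h x| ^ (1 / (1 - m)) * ψ x ^ (-(m / (1 - m))))
      {x | 0 < ψ x} μ) :
    ∫ x in {x | 0 < ψ x}, w x ^ m * |h x| ∂μ ≤ (∫ x, w x * ψ x ∂μ) ^ m *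
      (∫ x in {x | 0 < ψ x}, |h x| ^ (1 / (1 - m)) * ψ x ^ (-(m / (1 - m))) ∂μ) ^ (1 - m) := by
  have hp : 0 < 1 - m := by linarith
  set S := {x | 0 < ψ x} with hS
  have hSm : MeasurableSet S := measurableSet_lt measurable_const hψ
  have hwψ0 : ∀ x, 0 ≤ w x * ψ x := fun x => mul_nonneg (hw0 x) (hψ0 x)
  have hf0 : ∀ x, 0 ≤ (w x * ψ x) ^ m := fun x => Real.rpow_nonneg (hwψ0 x) _
  have hg0 : ∀ x, 0 ≤ |h x| * ψ x ^ (-m) := fun x =>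
    mul_nonneg (abs_nonneg _) (Real.rpow_nonneg (hψ0 x) _)
  have hfp : ∀ x, ((w x * ψ x) ^ m) ^ (1 / m) = w x * ψ x := fun x => by
    rw [← Real.rpow_mul (hwψ0 x), mul_one_div_cancel hm0.ne', Real.rpow_one]
  have hgq : ∀ x, (|h x| * ψ x ^ (-m)) ^ (1 / (1 - m)) =
      |h x| ^ (1 / (1 - m)) * ψ x ^ (-(m / (1 - m))) := fun x => by
    rw [Real.mul_rpow (abs_nonneg _) (Real.rpow_nonneg (hψ0 x) _), ← Real.rpow_mul (hψ0 x)]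
    congr 2
    ring
  have hpq : (1 / m).HolderConjugate (1 / (1 - m)) := by
    refine Real.holderConjugate_iff.2 ⟨(one_lt_div hm0).2 hm1, ?_⟩
    simp
  have hfL : MemLp (fun x => (w x * ψ x) ^ m) (ENNReal.ofReal (1 / m)) (μ.restrict S) := by
    refine (integrable_norm_rpow_iff ?_ ?_ ENNReal.ofReal_ne_top).1 ?_
    · exact (hwψ.aemeasurable.pow_const m).aestronglyMeasurable.restrict
    · simpa using hm0
    · rw [ENNReal.toReal_ofReal (by positivity)]
      simp only [Real.norm_of_nonneg (hf0 _), hfp]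
      exact hwψ.restrict
  have hgL : MemLp (fun x => |h x| * ψ x ^ (-m)) (ENNReal.ofReal (1 / (1 - m)))
      (μ.restrict S) := by
    refine (integrable_norm_rpow_iff ?_ ?_ ENNReal.ofReal_ne_top).1 ?_
    · have h1 : Measurable fun x => |h x| := by fun_prop
      exact (h1.mul (hψ.pow_const _)).aestronglyMeasurable
    · simpa using hm1
    · rw [ENNReal.toReal_ofReal (by positivity)]
      simp only [Real.norm_of_nonneg (hg0 _), hgq]
      exact hint
  have key := integral_mul_le_Lp_mul_Lq_of_nonneg hpq (ae_of_all _ hf0) (ae_of_all _ hg0) hfL hgL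
  simp only [hfp, hgq, one_div_one_div] at key
  calc ∫ x in S, w x ^ m * |h x| ∂μ
      = ∫ x in S, (w x * ψ x) ^ m * (|h x| * ψ x ^ (-m)) ∂μ := by
        refine setIntegral_congr_fun hSm fun x (hx : 0 < ψ x) => ?_
        have : ψ x ^ m ≠ 0 := (Real.rpow_pos_of_pos hx _).ne'
        simp only [Real.mul_rpow (hw0 x) hx.le, Real.rpow_neg hx.le]
        field_simp
    _ ≤ _ := key
    _ ≤ _ := by
        refine mul_le_mul_of_nonneg_right ?_ (Real.rpow_nonneg (setIntegral_nonneg hSm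
          fun x hx => mul_nonneg (Real.rpow_nonneg (abs_nonneg _) _)
            (Real.rpow_nonneg (hψ0 x) _)) _)
        refine Real.rpow_le_rpow (setIntegral_nonneg hSm fun x _ => hwψ0 x) ?_ hm0.le
        exact setIntegral_le_integral hwψ (ae_of_all _ hwψ0)

end Integrals

section Flow

variable {n : ℕ}

lemma contDiff_slice {T : ℝ} {u : ℝ × EuclideanSpace ℝ (Fin n) → ℝ}
    (hu : ContDiffOn ℝ ∞ u (Set.Icc 0 T ×ˢ Set.univ)) {t : ℝ} (ht : t ∈ Set.Icc 0 T) :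
    ContDiff ℝ ∞ fun x => u (t, x) :=
  contDiffOn_univ.1 (hu.comp (contDiff_const.prodMk contDiff_id).contDiffOn
    fun _ _ => ⟨ht, Set.mem_univ _⟩)

/-- The time derivative of a smooth function on a slab is bounded over a compact support. -/
lemma exists_bound_of_hasDerivWithinAt {T : ℝ} (hT : 0 < T)
    {u : ℝ × EuclideanSpace ℝ (Fin n) → ℝ} {u' : ℝ → EuclideanSpace ℝ (Fin n) → ℝ}
    (hu : ContDiffOn ℝ ∞ u (Set.Icc 0 T ×ˢ Set.univ))
    (hu' : ∀ t ∈ Set.Icc (0 : ℝ) T, ∀ x,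
      HasDerivWithinAt (fun s => u (s, x)) (u' t x) (Set.Icc 0 T) t)
    {ψ : EuclideanSpace ℝ (Fin n) → ℝ} (hψc : HasCompactSupport ψ) :
    ∃ M, ∀ t ∈ Set.Icc (0 : ℝ) T, ∀ x, ψ x ≠ 0 → |u' t x| ≤ M := by
  have hud : UniqueDiffOn ℝ (Set.Icc 0 T ×ˢ (Set.univ : Set (EuclideanSpace ℝ (Fin n)))) :=
    (uniqueDiffOn_Icc hT).prod uniqueDiffOn_univ
  have hc : ContinuousOn (fun p => fderivWithin ℝ u (Set.Icc 0 T ×ˢ Set.univ) p (1, 0))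
      (Set.Icc 0 T ×ˢ Set.univ) :=
    (hu.continuousOn_fderivWithin hud (by simp)).clm_apply continuousOn_const
  obtain ⟨M, hM⟩ := (isCompact_Icc.prod hψc).exists_bound_of_continuousOn
    (hc.mono (Set.prod_mono subset_rfl (Set.subset_univ _)))
  refine ⟨M, fun t ht x hx => ?_⟩
  have h1 : HasFDerivWithinAt u (fderivWithin ℝ u (Set.Icc 0 T ×ˢ Set.univ) (t, x))
      (Set.Icc 0 T ×ˢ Set.univ) (t, x) :=
    (hu.differentiableOn (by simp) (t, x) ⟨ht, Set.mem_univ _⟩).hasFDerivWithinAt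
  have h2 : HasDerivWithinAt (fun s => (s, x)) ((1 : ℝ), (0 : EuclideanSpace ℝ (Fin n)))
      (Set.Icc 0 T) t := (hasDerivWithinAt_id t _).prodMk (hasDerivWithinAt_const t _ x)
  have hmaps : Set.MapsTo (fun s => (s, x)) (Set.Icc 0 T) (Set.Icc 0 T ×ˢ Set.univ) :=
    fun s hs => ⟨hs, Set.mem_univ _⟩
  have h3 := h1.comp_hasDerivWithinAt t h2 hmaps
  have h4 := (uniqueDiffOn_Icc hT t ht).eq_deriv _ (hu' t ht x) h3
  rw [h4]
  exact hM (t, x) ⟨ht, subset_tsupport _ hx⟩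

/-- The spatial estimate behind the local `L¹`-stability of fast diffusion. -/
lemma integral_sign_mul_lap_rpow_sub_mul_le {m : ℝ} (hm0 : 0 < m) (hm1 : m < 1)
    {f g ψ : EuclideanSpace ℝ (Fin n) → ℝ} (hf : ContDiff ℝ ∞ f) (hg : ContDiff ℝ ∞ g)
    (hfpos : ∀ x, 0 < f x) (hgpos : ∀ x, 0 < g x) (hψ : ContDiff ℝ ∞ ψ)
    (hψc : HasCompactSupport ψ) (hψ0 : ∀ x, 0 ≤ ψ x)
    (hint : IntegrableOn (fun x => |lap ψ x| ^ (1 / (1 - m)) * ψ x ^ (-(m / (1 - m))))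
      {x | 0 < ψ x}) :
    ∫ x, Real.sign (f x - g x) * (lap (fun y => f y ^ m) x - lap (fun y => g y ^ m) x) * ψ x ≤
      (∫ x, |f x - g x| * ψ x) ^ m *
        (∫ x in {x | 0 < ψ x}, |lap ψ x| ^ (1 / (1 - m)) * ψ x ^ (-(m / (1 - m)))) ^ (1 - m) := by
  have hfm : ContDiff ℝ ∞ fun x => f x ^ m := hf.rpow_const_of_ne fun x => (hfpos x).ne'
  have hgm : ContDiff ℝ ∞ fun x => g x ^ m := hg.rpow_const_of_ne fun x => (hgpos x).ne'
  have hwc : Continuous fun x => |f x - g x| := (hf.continuous.sub hg.continuous).abs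
  have hlψ := hψ.lap.continuous
  calc _ = ∫ x, Real.sign (f x ^ m - g x ^ m) * lap (fun y => f y ^ m - g y ^ m) x * ψ x := by
        refine integral_congr_ae (ae_of_all _ fun x => ?_)
        simp only [lap_sub hfm hgm, sign_rpow_sub_rpow hm0 (hfpos x).le (hgpos x).le]
    _ ≤ ∫ x, |f x ^ m - g x ^ m| * lap ψ x :=
        integral_sign_mul_lap_mul_le (hfm.sub hgm) hψ hψc hψ0
    _ ≤ ∫ x, |f x - g x| ^ m * |lap ψ x| := by
        refine integral_mono ?_ ?_ fun x => ?_
        · exact ((hfm.continuous.sub hgm.continuous).abs.mul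
            hlψ).integrable_of_hasCompactSupport hψc.lap.mul_left
        · exact ((hwc.rpow_const fun x => Or.inr hm0.le).mul
            hlψ.abs).integrable_of_hasCompactSupport hψc.lap.abs.mul_left
        · exact (mul_le_mul_of_nonneg_left (le_abs_self _) (abs_nonneg _)).trans
            (mul_le_mul_of_nonneg_right
              (abs_rpow_sub_rpow_le hm0.le hm1.le (hfpos x).le (hgpos x).le) (abs_nonneg _))
    _ = ∫ x in {x | 0 < ψ x}, |f x - g x| ^ m * |lap ψ x| := by
        refine (setIntegral_eq_integral_of_ae_compl_eq_zero ?_).symm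
        filter_upwards [ae_lap_eq_zero_of_eq_zero hψ hψ0] with x hx hxs
        have : ψ x = 0 := le_antisymm (not_lt.1 hxs) (hψ0 x)
        simp [hx this]
    _ ≤ _ := setIntegral_rpow_mul_le hm0 hm1 hψ.continuous.measurable hψ0 hlψ.measurable
        (fun x => abs_nonneg _)
        ((hwc.mul hψ.continuous).integrable_of_hasCompactSupport hψc.mul_left) hint

end Flow

/-- The local `L¹`-stability inequality for the Yamabe flow in porous-medium form
`∂ₜ u = c_n Δ(u^m)` on flat `ℝ^n`. -/
theorem yamabe_flow_L1_stability (n : ℕ) (hn : 3 ≤ n) (m cn T : ℝ)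
    (hm : m = ((n : ℝ) - 2) / ((n : ℝ) + 2)) (hcn : cn = 4 * ((n : ℝ) - 1) / ((n : ℝ) - 2))
    (hT : 0 < T)
    (u v : ℝ × EuclideanSpace ℝ (Fin n) → ℝ)
    (hu : ContDiffOn ℝ (⊤ : ℕ∞) u (Set.Icc 0 T ×ˢ Set.univ))
    (hv : ContDiffOn ℝ (⊤ : ℕ∞) v (Set.Icc 0 T ×ˢ Set.univ))
    (hupos : ∀ t ∈ Set.Icc (0 : ℝ) T, ∀ x, 0 < u (t, x))
    (hvpos : ∀ t ∈ Set.Icc (0 : ℝ) T, ∀ x, 0 < v (t, x))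
    (huflow : ∀ t ∈ Set.Icc (0 : ℝ) T, ∀ x,
      HasDerivWithinAt (fun s => u (s, x)) (cn * lap (fun y => u (t, y) ^ m) x)
        (Set.Icc 0 T) t)
    (hvflow : ∀ t ∈ Set.Icc (0 : ℝ) T, ∀ x,
      HasDerivWithinAt (fun s => v (s, x)) (cn * lap (fun y => v (t, y) ^ m) x)
        (Set.Icc 0 T) t)
    (R₀ : ℝ) (hR₀ : 0 < R₀)
    (hout : ∀ t ∈ Set.Icc (0 : ℝ) T, ∀ x : EuclideanSpace ℝ (Fin n),
      R₀ ≤ ‖x‖ → u (t, x) = v (t, x))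
    (ψ : EuclideanSpace ℝ (Fin n) → ℝ) (hψ : ContDiff ℝ (⊤ : ℕ∞) ψ) (hψc : HasCompactSupport ψ)
    (hψ01 : ∀ x, 0 ≤ ψ x ∧ ψ x ≤ 1)
    (hCψ : IntegrableOn
      (fun x => |lap ψ x| ^ (1 / (1 - m)) * ψ x ^ (-(m / (1 - m))))
      {x | 0 < ψ x}) :
    ∀ s t : ℝ, 0 ≤ s → s ≤ t → t ≤ T →
      (∫ x, |u (t, x) - v (t, x)| * ψ x) ^ (1 - m) ≤
        (∫ x, |u (s, x) - v (s, x)| * ψ x) ^ (1 - m) +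
          (1 - m) * cn *
            (∫ x in {x | 0 < ψ x},
              |lap ψ x| ^ (1 / (1 - m)) * ψ x ^ (-(m / (1 - m)))) ^ (1 - m) *
            (t - s) := by
  have hn3 : (3 : ℝ) ≤ n := by exact_mod_cast hn
  have hm0 : 0 < m := by rw [hm]; exact div_pos (by linarith) (by linarith)
  have hm1 : m < 1 := by rw [hm, div_lt_one (by linarith)]; linarith
  have hcn0 : 0 ≤ cn := by rw [hcn]; exact div_nonneg (by linarith) (by linarith)
  have hψ0 : ∀ x, 0 ≤ ψ x := fun x => (hψ01 x).1
  intro s t hs hst htT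
  have hsub : Set.Icc s t ⊆ Set.Icc 0 T := Set.Icc_subset_Icc hs htT
  have hut := fun τ hτ => contDiff_slice hu (t := τ) hτ
  have hvt := fun τ hτ => contDiff_slice hv (t := τ) hτ
  have hupow : ∀ τ ∈ Set.Icc 0 T, ContDiff ℝ (⊤ : ℕ∞) fun x => u (τ, x) ^ m := fun τ hτ =>
    (hut τ hτ).rpow_const_of_ne fun x => (hupos τ hτ x).ne'
  have hvpow : ∀ τ ∈ Set.Icc 0 T, ContDiff ℝ (⊤ : ℕ∞) fun x => v (τ, x) ^ m := fun τ hτ =>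
    (hvt τ hτ).rpow_const_of_ne fun x => (hvpos τ hτ x).ne'
  have hwc : ∀ τ ∈ Set.Icc 0 T, Continuous fun x => u (τ, x) - v (τ, x) := fun τ hτ =>
    (hut τ hτ).continuous.sub (hvt τ hτ).continuous
  have hint : ∀ τ ∈ Set.Icc 0 T, Integrable fun x => |u (τ, x) - v (τ, x)| * ψ x := fun τ hτ =>
    ((hwc τ hτ).abs.mul hψ.continuous).integrable_of_hasCompactSupport hψc.mul_left
  obtain ⟨M, hM⟩ := exists_bound_of_hasDerivWithinAt hT hu huflow hψc
  obtain ⟨M', hM'⟩ := exists_bound_of_hasDerivWithinAt hT hv hvflow hψc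
  set C := ∫ x in {x | 0 < ψ x}, |lap ψ x| ^ (1 / (1 - m)) * ψ x ^ (-(m / (1 - m))) with hC
  have hC0 : 0 ≤ C := integral_nonneg fun x =>
    mul_nonneg (Real.rpow_nonneg (abs_nonneg _) _) (Real.rpow_nonneg (hψ0 x) _)
  have hdini : ∀ τ ∈ Set.Icc 0 T,
      ∫ x, Real.sign (u (τ, x) - v (τ, x)) *
        (cn * lap (fun y => u (τ, y) ^ m) x - cn * lap (fun y => v (τ, y) ^ m) x) * ψ x ≤
      cn * C ^ (1 - m) * (∫ x, |u (τ, x) - v (τ, x)| * ψ x) ^ m := fun τ hτ => by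
    have h := integral_sign_mul_lap_rpow_sub_mul_le hm0 hm1 (hut τ hτ) (hvt τ hτ)
      (hupos τ hτ) (hvpos τ hτ) hψ hψc hψ0 hCψ
    calc _ = cn * ∫ x, Real.sign (u (τ, x) - v (τ, x)) *
        (lap (fun y => u (τ, y) ^ m) x - lap (fun y => v (τ, y) ^ m) x) * ψ x := by
          rw [← integral_const_mul]
          exact integral_congr_ae (ae_of_all _ fun x => by ring)
      _ ≤ cn * ((∫ x, |u (τ, x) - v (τ, x)| * ψ x) ^ m * C ^ (1 - m)) := by gcongr
      _ = _ := by ring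
  have hcont : ContinuousOn (fun τ => ∫ x, |u (τ, x) - v (τ, x)| * ψ x) (Set.Icc s t) := by
    refine ContinuousOn.mono ?_ hsub
    refine continuousOn_integral_of_compact_support (k := tsupport ψ) hψc ?_ ?_
    · exact (hu.continuousOn.sub hv.continuousOn).abs.mul
        (hψ.continuous.comp continuous_snd).continuousOn
    · intro p x _ hx
      simp [image_eq_zero_of_notMem_tsupport hx]
  have key := rpow_one_sub_le_of_left_slope_le
    (f := fun τ => ∫ x, |u (τ, x) - v (τ, x)| * ψ x) (K := cn * C ^ (1 - m)) hst hm1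
    (mul_nonneg hcn0 (Real.rpow_nonneg hC0 _))
    (fun τ => integral_nonneg fun x => mul_nonneg (abs_nonneg _) (hψ0 x)) hcont
    fun τ hτ r hr => eventually_slope_integral_abs_mul_lt (a := 0) (b := T) (M := M + M')
      (w := fun τ x => u (τ, x) - v (τ, x))
      (fun τ hτ => (hwc τ hτ).aestronglyMeasurable) hint
      (hψ.continuous.integrable_of_hasCompactSupport hψc) hψ0
      (fun τ hτ x => (huflow τ hτ x).sub (hvflow τ hτ x))
      (fun τ hτ x hx => (abs_sub _ _).trans
        (add_le_add (hM τ hτ x hx) (hM' τ hτ x hx)))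
      ⟨hs.trans_lt hτ.1, hτ.2.trans htT⟩
      ((hdini τ (hsub ⟨hτ.1.le, hτ.2⟩)).trans_lt hr)
  rw [mul_assoc (1 - m)]
  exact key
end
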